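/- arXiv:2406.09917 — 3 statements merged into one kernel-verified Lean document; each statement's English description precedes it below -/
import Mathlib

section
/- Let f_{s1}, f_{s2}, g_{s1}, g_{s2}, h_s (s=1,2) and κ1, κ2 be as in the context. Let v1, v2 : ℝ × ℝ → ℝ, written (z,t) ↦ v_s(z,t), be such that for each fixed t the functions z ↦ v_s(z,t) are twice continuously differentiable and the partial derivative ∂v_s/∂t exists everywhere. Suppose that ∂v_s/∂t(z,t) = F_s(v1(·,t), v2(·,t))(z) for all (z,t) ∈ ℝ² and s = 1,2. Then the functions u_s(x1,x2,t) := v_s(κ1·x1 + κ2·x2, t) satisfy ∂u_s/∂t(x1,x2,t) = H_s(u1(·,·,t), u2(·,·,t))(x1,x2) for all (x1,x2,t) ∈ ℝ³ and s = 1,2. -/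
/-- First-variable partial derivative of a function of two real variables. -/
noncomputable def pd1 (u : ℝ × ℝ → ℝ) (p : ℝ × ℝ) : ℝ :=
  deriv (fun x => u (x, p.2)) p.1

/-- Second-variable partial derivative of a function of two real variables. -/
noncomputable def pd2 (u : ℝ × ℝ → ℝ) (p : ℝ × ℝ) : ℝ :=
  deriv (fun y => u (p.1, y)) p.2

/-- The (2+1)-dimensional reaction–diffusion operator
`H(u1,u2) = ∂/∂x1(f1(u1,u2)·∂u1/∂x1 + f2(u1,u2)·∂u2/∂x1)
          + ∂/∂x2(g1(u1,u2)·∂u1/∂x2 + g2(u1,u2)·∂u2/∂x2) + h(u1,u2)`. -/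
noncomputable def Hop (f1 f2 g1 g2 h : ℝ × ℝ → ℝ) (u1 u2 : ℝ × ℝ → ℝ) (p : ℝ × ℝ) : ℝ :=
  deriv (fun x => f1 (u1 (x, p.2), u2 (x, p.2)) * pd1 u1 (x, p.2)
        + f2 (u1 (x, p.2), u2 (x, p.2)) * pd1 u2 (x, p.2)) p.1
  + deriv (fun y => g1 (u1 (p.1, y), u2 (p.1, y)) * pd2 u1 (p.1, y)
        + g2 (u1 (p.1, y), u2 (p.1, y)) * pd2 u2 (p.1, y)) p.2
  + h (u1 p, u2 p)

/-- The reduced (1+1)-dimensional operator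
`F(v1,v2)(z) = d/dz[(κ1²f1+κ2²g1)(v1,v2)·v1' + (κ1²f2+κ2²g2)(v1,v2)·v2'] + h(v1,v2)`. -/
noncomputable def Fop (κ1 κ2 : ℝ) (f1 f2 g1 g2 h : ℝ × ℝ → ℝ) (v1 v2 : ℝ → ℝ) (z : ℝ) : ℝ :=
  deriv (fun w => (κ1 ^ 2 * f1 (v1 w, v2 w) + κ2 ^ 2 * g1 (v1 w, v2 w)) * deriv v1 w
        + (κ1 ^ 2 * f2 (v1 w, v2 w) + κ2 ^ 2 * g2 (v1 w, v2 w)) * deriv v2 w) z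
  + h (v1 z, v2 z)

theorem deriv_comp_mul_left_add_const (φ : ℝ → ℝ) (a b x : ℝ) :
    deriv (fun y => φ (a * y + b)) x = a * deriv φ (a * x + b) := by
  have h := deriv_comp_mul_left a (fun y => φ (y + b)) x
  rwa [deriv_comp_add_const, smul_eq_mul] at h

theorem deriv_comp_const_add_mul_left (φ : ℝ → ℝ) (a b x : ℝ) :
    deriv (fun y => φ (b + a * y)) x = a * deriv φ (b + a * x) := by
  simpa only [add_comm b] using deriv_comp_mul_left_add_const φ a b x

theorem Hop_comp_linear {κ1 κ2 : ℝ} {f1 f2 g1 g2 : ℝ × ℝ → ℝ} (h : ℝ × ℝ → ℝ) {v1 v2 : ℝ → ℝ}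
    (hf1 : ContDiff ℝ 1 f1) (hf2 : ContDiff ℝ 1 f2)
    (hg1 : ContDiff ℝ 1 g1) (hg2 : ContDiff ℝ 1 g2)
    (hv1 : ContDiff ℝ 2 v1) (hv2 : ContDiff ℝ 2 v2) (p : ℝ × ℝ) :
    Hop f1 f2 g1 g2 h (fun q => v1 (κ1 * q.1 + κ2 * q.2)) (fun q => v2 (κ1 * q.1 + κ2 * q.2)) p
      = Fop κ1 κ2 f1 f2 g1 g2 h v1 v2 (κ1 * p.1 + κ2 * p.2) := by
  have hv : Differentiable ℝ (fun w => (v1 w, v2 w)) :=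
    (hv1.differentiable two_ne_zero).prodMk (hv2.differentiable two_ne_zero)
  have hflux {a b : ℝ × ℝ → ℝ} (ha : ContDiff ℝ 1 a) (hb : ContDiff ℝ 1 b) :
      Differentiable ℝ
        (fun w => a (v1 w, v2 w) * deriv v1 w + b (v1 w, v2 w) * deriv v2 w) :=
    (((ha.differentiable one_ne_zero).comp hv).mul
      (hv1.differentiable_deriv_two)).add
      (((hb.differentiable one_ne_zero).comp hv).mul (hv2.differentiable_deriv_two))
  set Φ := fun w => f1 (v1 w, v2 w) * deriv v1 w + f2 (v1 w, v2 w) * deriv v2 w with hΦ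
  set Γ := fun w => g1 (v1 w, v2 w) * deriv v1 w + g2 (v1 w, v2 w) * deriv v2 w with hΓ
  have hF : (fun w => (κ1 ^ 2 * f1 (v1 w, v2 w) + κ2 ^ 2 * g1 (v1 w, v2 w)) * deriv v1 w
        + (κ1 ^ 2 * f2 (v1 w, v2 w) + κ2 ^ 2 * g2 (v1 w, v2 w)) * deriv v2 w)
      = fun w => κ1 ^ 2 * Φ w + κ2 ^ 2 * Γ w := by
    funext w; simp only [hΦ, hΓ]; ring
  have hX (c : ℝ) : (fun x => f1 (v1 (κ1 * x + c), v2 (κ1 * x + c)) * (κ1 * deriv v1 (κ1 * x + c))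
        + f2 (v1 (κ1 * x + c), v2 (κ1 * x + c)) * (κ1 * deriv v2 (κ1 * x + c)))
      = fun x => κ1 * Φ (κ1 * x + c) := by
    funext x; simp only [hΦ]; ring
  have hY (c : ℝ) : (fun y => g1 (v1 (c + κ2 * y), v2 (c + κ2 * y)) * (κ2 * deriv v1 (c + κ2 * y))
        + g2 (v1 (c + κ2 * y), v2 (c + κ2 * y)) * (κ2 * deriv v2 (c + κ2 * y)))
      = fun y => κ2 * Γ (c + κ2 * y) := by
    funext y; simp only [hΓ]; ring
  simp only [Hop, Fop, pd1, pd2]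
  simp only [deriv_comp_mul_left_add_const v1, deriv_comp_mul_left_add_const v2,
    deriv_comp_const_add_mul_left v1, deriv_comp_const_add_mul_left v2]
  rw [hF, hX, hY, deriv_const_mul_field, deriv_const_mul_field,
    deriv_comp_mul_left_add_const Φ, deriv_comp_const_add_mul_left Γ,
    deriv_fun_add ((hflux hf1 hf2 _).const_mul _) ((hflux hg1 hg2 _).const_mul _),
    deriv_const_mul_field, deriv_const_mul_field]
  ring

/-- if `v_s(z,t)` solves the reduced (1+1)-dimensional first-order-in-time
system `∂v_s/∂t = F_s(v1(·,t), v2(·,t))`, then `u_s(x1,x2,t) := v_s(κ1·x1+κ2·x2, t)`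
solves `∂u_s/∂t = H_s(u1(·,·,t), u2(·,·,t))`. -/
theorem stmt2 (κ1 κ2 : ℝ)
    (f g : Fin 2 → Fin 2 → ℝ × ℝ → ℝ) (h : Fin 2 → ℝ × ℝ → ℝ)
    (hf : ∀ s i, ContDiff ℝ 1 (f s i)) (hg : ∀ s i, ContDiff ℝ 1 (g s i))
    (hh : ∀ s, Continuous (h s))
    (v : Fin 2 → ℝ → ℝ → ℝ)
    (hz : ∀ s t, ContDiff ℝ 2 (fun z => v s z t))
    (ht : ∀ s z t, DifferentiableAt ℝ (fun τ => v s z τ) t)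
    (heq : ∀ s : Fin 2, ∀ z t : ℝ,
      deriv (fun τ => v s z τ) t
        = Fop κ1 κ2 (f s 0) (f s 1) (g s 0) (g s 1) (h s)
            (fun w => v 0 w t) (fun w => v 1 w t) z) :
    ∀ s : Fin 2, ∀ x1 x2 t : ℝ,
      deriv (fun τ => v s (κ1 * x1 + κ2 * x2) τ) t
      = Hop (f s 0) (f s 1) (g s 0) (g s 1) (h s)
          (fun p => v 0 (κ1 * p.1 + κ2 * p.2) t)
          (fun p => v 1 (κ1 * p.1 + κ2 * p.2) t) (x1, x2) := by
  intro s x1 x2 t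
  rw [heq]
  exact (Hop_comp_linear (h s) (hf s 0) (hf s 1) (hg s 0) (hg s 1) (hz 0 t) (hz 1 t)
    (x1, x2)).symm
end

section
/- Let f_{s1}, f_{s2}, g_{s1}, g_{s2}, h_s (s=1,2) and κ1, κ2 be as in the context, with (κ1,κ2) ≠ (0,0). For s = 1,2 let φ_{s,1}, …, φ_{s,n_s} : ℝ → ℝ be twice continuously differentiable and linearly independent over ℝ. Suppose K_{s,i} : ℝ^{n_1} × ℝ^{n_2} → ℝ (s = 1,2, 1 ≤ i ≤ n_s) are functions such that for every c = (c_{1,1},…,c_{1,n_1},c_{2,1},…,c_{2,n_2}) one has F_s(Σ_{i=1}^{n_1} c_{1,i}·φ_{1,i}, Σ_{i=1}^{n_2} c_{2,i}·φ_{2,i})(z) = Σ_{i=1}^{n_s} K_{s,i}(c)·φ_{s,i}(z) for all z ∈ ℝ. Let k_{s,i} : ℝ → ℝ be differentiable and set u_s(x1,x2,t) = Σ_{i=1}^{n_s} k_{s,i}(t)·φ_{s,i}(κ1·x1 + κ2·x2). Then ∂u_s/∂t(x1,x2,t) = H_s(u1(·,·,t), u2(·,·,t))(x1,x2) holds for all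 (x1,x2,t) ∈ ℝ³ and s = 1,2 if and only if k_{s,i}'(t) = K_{s,i}(k_{1,1}(t),…,k_{1,n_1}(t),k_{2,1}(t),…,k_{2,n_2}(t)) for all t ∈ ℝ, s = 1,2 and 1 ≤ i ≤ n_s. -/
theorem deriv_comp_mul_add_const (F : ℝ → ℝ) (a b x : ℝ) :
    deriv (fun y => F (a * y + b)) x = a * deriv F (a * x + b) := by
  rw [deriv_comp_mul_left a (fun y => F (y + b)) x, deriv_comp_add_const, smul_eq_mul]

theorem pd1_planeWave (κ1 κ2 : ℝ) (v : ℝ → ℝ) (p : ℝ × ℝ) :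
    pd1 (fun q => v (κ1 * q.1 + κ2 * q.2)) p = κ1 * deriv v (κ1 * p.1 + κ2 * p.2) :=
  deriv_comp_mul_add_const v κ1 (κ2 * p.2) p.1

theorem pd2_planeWave (κ1 κ2 : ℝ) (v : ℝ → ℝ) (p : ℝ × ℝ) :
    pd2 (fun q => v (κ1 * q.1 + κ2 * q.2)) p = κ2 * deriv v (κ1 * p.1 + κ2 * p.2) := by
  have := deriv_comp_mul_add_const v κ2 (κ1 * p.1) p.2
  simpa only [pd2, add_comm (κ1 * p.1)] using this

/-- The flux `a(v1,v2)·v1' + b(v1,v2)·v2'` is differentiable. -/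
theorem differentiable_flux {a b : ℝ × ℝ → ℝ} (ha : ContDiff ℝ 1 a) (hb : ContDiff ℝ 1 b)
    {v1 v2 : ℝ → ℝ} (hv1 : ContDiff ℝ 2 v1) (hv2 : ContDiff ℝ 2 v2) :
    Differentiable ℝ (fun w => a (v1 w, v2 w) * deriv v1 w + b (v1 w, v2 w) * deriv v2 w) := by
  have hv : Differentiable ℝ (fun w => (v1 w, v2 w)) :=
    (hv1.differentiable (by norm_num)).prodMk (hv2.differentiable (by norm_num))
  have hd : ∀ {v : ℝ → ℝ}, ContDiff ℝ 2 v → Differentiable ℝ (deriv v) := fun h =>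
    ((contDiff_succ_iff_deriv (n := 1)).1 h).2.2.differentiable (by norm_num)
  exact (((ha.differentiable (by norm_num)).comp hv).mul (hd hv1)).add
    (((hb.differentiable (by norm_num)).comp hv).mul (hd hv2))

/-- On functions of `κ1·x1 + κ2·x2` the operator `Hop` reduces to `Fop`. -/
theorem Hop_planeWave (κ1 κ2 : ℝ) {f1 f2 g1 g2 : ℝ × ℝ → ℝ} (h : ℝ × ℝ → ℝ)
    (hf1 : ContDiff ℝ 1 f1) (hf2 : ContDiff ℝ 1 f2)
    (hg1 : ContDiff ℝ 1 g1) (hg2 : ContDiff ℝ 1 g2)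
    {v1 v2 : ℝ → ℝ} (hv1 : ContDiff ℝ 2 v1) (hv2 : ContDiff ℝ 2 v2) (p : ℝ × ℝ) :
    Hop f1 f2 g1 g2 h (fun q => v1 (κ1 * q.1 + κ2 * q.2)) (fun q => v2 (κ1 * q.1 + κ2 * q.2)) p
      = Fop κ1 κ2 f1 f2 g1 g2 h v1 v2 (κ1 * p.1 + κ2 * p.2) := by
  set A : ℝ → ℝ := fun w => f1 (v1 w, v2 w) * deriv v1 w + f2 (v1 w, v2 w) * deriv v2 w with hA
  set B : ℝ → ℝ := fun w => g1 (v1 w, v2 w) * deriv v1 w + g2 (v1 w, v2 w) * deriv v2 w with hB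
  have hAd : Differentiable ℝ A := differentiable_flux hf1 hf2 hv1 hv2
  have hBd : Differentiable ℝ B := differentiable_flux hg1 hg2 hv1 hv2
  have hF : deriv (fun w => (κ1 ^ 2 * f1 (v1 w, v2 w) + κ2 ^ 2 * g1 (v1 w, v2 w)) * deriv v1 w
        + (κ1 ^ 2 * f2 (v1 w, v2 w) + κ2 ^ 2 * g2 (v1 w, v2 w)) * deriv v2 w)
        (κ1 * p.1 + κ2 * p.2)
      = κ1 ^ 2 * deriv A (κ1 * p.1 + κ2 * p.2) + κ2 ^ 2 * deriv B (κ1 * p.1 + κ2 * p.2) := by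
    have := (((hAd (κ1 * p.1 + κ2 * p.2)).hasDerivAt.const_mul (κ1 ^ 2)).add
      ((hBd (κ1 * p.1 + κ2 * p.2)).hasDerivAt.const_mul (κ2 ^ 2))).deriv
    rw [← this]
    congr 1
    funext w
    simp only [hA, hB, Pi.add_apply]
    ring
  have hH1 := pd1_planeWave κ1 κ2 (fun w => κ1 * A w) p
  have hH2 := pd2_planeWave κ1 κ2 (fun w => κ2 * B w) p
  rw [deriv_const_mul_field] at hH1 hH2
  simp only [Hop, Fop, pd1_planeWave, pd2_planeWave]
  rw [hF]
  congr 1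
  refine congrArg₂ (· + ·) ?_ ?_
  · rw [pow_two, mul_assoc, ← hH1, pd1]
    congr 1
    funext x
    simp only [hA]
    ring
  · rw [pow_two, mul_assoc, ← hH2, pd2]
    congr 1
    funext y
    simp only [hB]
    ring

theorem exists_linear_combination_eq {κ1 κ2 : ℝ} (hκ : (κ1, κ2) ≠ (0, 0)) (z : ℝ) :
    ∃ x1 x2 : ℝ, κ1 * x1 + κ2 * x2 = z := by
  by_cases h1 : κ1 = 0
  · have h2 : κ2 ≠ 0 := fun h2 => hκ (by rw [h1, h2])
    exact ⟨0, z / κ2, by field_simp; ring⟩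
  · exact ⟨z / κ1, 0, by field_simp; ring⟩

theorem LinearIndependent.eq_coeffs_of_sum_mul_eq {ι : Type*} [Fintype ι] {φ : ι → ℝ → ℝ}
    (hφ : LinearIndependent ℝ φ) {a b : ι → ℝ}
    (hab : ∀ z, ∑ i, a i * φ i z = ∑ i, b i * φ i z) : a = b := by
  refine hφ.fintypeLinearCombination_injective ?_
  funext z
  simpa [Fintype.linearCombination_apply, Finset.sum_apply] using hab z

/-- with an invariant linear product space spanned by the `φ_{s,i}` and
expansion coefficients `K_{s,i}`, the generalized separable function
`u_s = Σ_i k_{s,i}(t)·φ_{s,i}(κ1·x1+κ2·x2)` solves the first-order-in-time system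
`∂u_s/∂t = H_s(u1,u2)` iff the coefficients solve `k_{s,i}' = K_{s,i}(k)`. -/
theorem stmt4 (κ1 κ2 : ℝ) (hκ : (κ1, κ2) ≠ (0, 0))
    (f g : Fin 2 → Fin 2 → ℝ × ℝ → ℝ) (h : Fin 2 → ℝ × ℝ → ℝ)
    (hf : ∀ s i, ContDiff ℝ 1 (f s i)) (hg : ∀ s i, ContDiff ℝ 1 (g s i))
    (hh : ∀ s, Continuous (h s))
    (n : Fin 2 → ℕ) (φ : (s : Fin 2) → Fin (n s) → ℝ → ℝ)
    (hφ : ∀ s i, ContDiff ℝ 2 (φ s i))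
    (hind : ∀ s, LinearIndependent ℝ (φ s))
    (K : (s : Fin 2) → Fin (n s) → ((s : Fin 2) → Fin (n s) → ℝ) → ℝ)
    (hK : ∀ c : (s : Fin 2) → Fin (n s) → ℝ, ∀ s : Fin 2, ∀ z : ℝ,
      Fop κ1 κ2 (f s 0) (f s 1) (g s 0) (g s 1) (h s)
        (fun w => ∑ i, c 0 i * φ 0 i w) (fun w => ∑ i, c 1 i * φ 1 i w) z
      = ∑ i, K s i c * φ s i z)
    (k : (s : Fin 2) → Fin (n s) → ℝ → ℝ)
    (hk : ∀ s i, Differentiable ℝ (k s i)) :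
    (∀ s : Fin 2, ∀ x1 x2 t : ℝ,
        deriv (fun τ => ∑ i, k s i τ * φ s i (κ1 * x1 + κ2 * x2)) t
        = Hop (f s 0) (f s 1) (g s 0) (g s 1) (h s)
            (fun p => ∑ i, k 0 i t * φ 0 i (κ1 * p.1 + κ2 * p.2))
            (fun p => ∑ i, k 1 i t * φ 1 i (κ1 * p.1 + κ2 * p.2)) (x1, x2))
    ↔
    (∀ s : Fin 2, ∀ i : Fin (n s), ∀ t : ℝ,
        deriv (k s i) t = K s i (fun s' i' => k s' i' t)) := by
  have hv : ∀ (s : Fin 2) (t : ℝ), ContDiff ℝ 2 (fun w => ∑ i, k s i t * φ s i w) :=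
    fun s t => ContDiff.sum fun i _ => contDiff_const.mul (hφ s i)
  have hR : ∀ (s : Fin 2) (x1 x2 t : ℝ),
      Hop (f s 0) (f s 1) (g s 0) (g s 1) (h s)
        (fun p => ∑ i, k 0 i t * φ 0 i (κ1 * p.1 + κ2 * p.2))
        (fun p => ∑ i, k 1 i t * φ 1 i (κ1 * p.1 + κ2 * p.2)) (x1, x2)
      = ∑ i, K s i (fun s' i' => k s' i' t) * φ s i (κ1 * x1 + κ2 * x2) := fun s x1 x2 t =>
    (Hop_planeWave κ1 κ2 (h s) (hf s 0) (hf s 1) (hg s 0) (hg s 1) (hv 0 t) (hv 1 t)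
      (x1, x2)).trans (hK (fun s' i' => k s' i' t) s _)
  have hL : ∀ (s : Fin 2) (z t : ℝ),
      deriv (fun τ => ∑ i, k s i τ * φ s i z) t = ∑ i, deriv (k s i) t * φ s i z :=
    fun s z t => (HasDerivAt.fun_sum fun i _ => ((hk s i t).hasDerivAt.mul_const _)).deriv
  simp only [hL, hR]
  constructor
  · intro H s i t
    refine congrFun ((hind s).eq_coeffs_of_sum_mul_eq (a := fun i => deriv (k s i) t)
      (b := fun i => K s i fun s' i' => k s' i' t) fun z => ?_) i
    obtain ⟨x1, x2, rfl⟩ := exists_linear_combination_eq hκ z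
    exact H s x1 x2 t
  · intro H s x1 x2 t
    simp only [H]
end

section
/- Fix real parameters κ1, γ10, η20, μ10, μ11, μ12, μ20, μ21, μ22 and β ≠ 0. For twice continuously differentiable v1, v2 : ℝ → ℝ define A_1(v1,v2)(z) = d/dz[ (κ1²·γ10 + (μ12/(3β²))·v2(z))·v1'(z) − ((μ11/β²) + (μ12/(3β²))·v1(z))·v2'(z) ] + μ10·v1(z) + μ11·v2(z) + μ12·v1(z)·v2(z) and A_2(v1,v2)(z) = d/dz[ ((μ20/(2β²)) + (μ22/(3β²))·v2(z))·v1'(z) + (κ1²·η20 − (μ22/(3β²))·v1(z))·v2'(z) ] + μ20·v1(z) + μ21·v2(z) + μ22·v1(z)·v2(z). Then for all p1, p2, q1, q2 ∈ ℝ, taking v1(z) = p1·sin(√2·β·z) + p2·cos(√2·β·z) and v2(z) = q1·e^{−βz} + q2·e^{βz}, one has A_1(v1,v2)(z) = (μ10 − 2β²·κ1²·γ10)·v1(z) and A_2(v1,v2)(z) = (μ21 + β²·κ1²·η20)·v2(z) for every z ∈ ℝ. -/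
/-- The reduced two-component operator
`A(v1,v2)(z) = d/dz[Φ(v1(z),v2(z))·v1'(z) + Ψ(v1(z),v2(z))·v2'(z)] + h(v1(z),v2(z))`. -/
noncomputable def Aop (Φ Ψ h : ℝ → ℝ → ℝ) (v1 v2 : ℝ → ℝ) (z : ℝ) : ℝ :=
  deriv (fun w => Φ (v1 w) (v2 w) * deriv v1 w + Ψ (v1 w) (v2 w) * deriv v2 w) z
  + h (v1 z) (v2 z)

/-- When `Φ` is affine in the second argument and `Ψ` in the first, with opposite slopes, the
cross terms `v1' * v2'` cancel. -/
theorem Aop_of_affine {a b m : ℝ} {h : ℝ → ℝ → ℝ} {v1 v2 v1' v2' : ℝ → ℝ} {v1'' v2'' z : ℝ}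
    (h1 : ∀ w, HasDerivAt v1 (v1' w) w) (h2 : ∀ w, HasDerivAt v2 (v2' w) w)
    (h1' : HasDerivAt v1' v1'' z) (h2' : HasDerivAt v2' v2'' z) :
    Aop (fun _ w2 => a + m * w2) (fun w1 _ => b - m * w1) h v1 v2 z
      = (a + m * v2 z) * v1'' + (b - m * v1 z) * v2'' + h (v1 z) (v2 z) := by
  have e1 : deriv v1 = v1' := funext fun w => (h1 w).deriv
  have e2 : deriv v2 = v2' := funext fun w => (h2 w).deriv
  have key := ((((h2 z).const_mul m).const_add a).fun_mul h1').fun_add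
    ((((h1 z).const_mul m).const_sub b).fun_mul h2')
  rw [Aop, e1, e2, key.deriv]
  ring

theorem hasDerivAt_sin_add_cos (p q c w : ℝ) :
    HasDerivAt (fun w => p * Real.sin (c * w) + q * Real.cos (c * w))
      (-(c * q) * Real.sin (c * w) + c * p * Real.cos (c * w)) w := by
  have hc : HasDerivAt (fun w => c * w) c w := by
    simpa using (hasDerivAt_id w).const_mul c
  refine ((hc.sin.const_mul p).fun_add (hc.cos.const_mul q)).congr_deriv ?_
  ring

theorem hasDerivAt_exp_neg_add_exp (p q c w : ℝ) :
    HasDerivAt (fun w => p * Real.exp (-c * w) + q * Real.exp (c * w))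
      (-(c * p) * Real.exp (-c * w) + c * q * Real.exp (c * w)) w := by
  have hc (d : ℝ) : HasDerivAt (fun w => d * w) d w := by
    simpa using (hasDerivAt_id w).const_mul d
  refine (((hc (-c)).exp.const_mul p).fun_add ((hc c).exp.const_mul q)).congr_deriv ?_
  ring

/-- Example 3.3, μ13 = μ14 = μ23 = μ24 = 0: the product space
`span{sin(√2·βz), cos(√2·βz)} × span{e^{−βz}, e^{βz}}` is invariant, with the displayed
scalar actions. -/
theorem stmt15 (κ1 γ10 η20 μ10 μ11 μ12 μ20 μ21 μ22 β : ℝ) (hβ : β ≠ 0) :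
    ∀ p1 p2 q1 q2 z : ℝ,
      (Aop (fun _ w2 => κ1 ^ 2 * γ10 + (μ12 / (3 * β ^ 2)) * w2)
          (fun w1 _ => -(μ11 / β ^ 2 + (μ12 / (3 * β ^ 2)) * w1))
          (fun w1 w2 => μ10 * w1 + μ11 * w2 + μ12 * w1 * w2)
          (fun w => p1 * Real.sin (Real.sqrt 2 * β * w) + p2 * Real.cos (Real.sqrt 2 * β * w))
          (fun w => q1 * Real.exp (-β * w) + q2 * Real.exp (β * w)) z
        = (μ10 - 2 * β ^ 2 * κ1 ^ 2 * γ10)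
          * (p1 * Real.sin (Real.sqrt 2 * β * z) + p2 * Real.cos (Real.sqrt 2 * β * z)))
      ∧
      (Aop (fun _ w2 => μ20 / (2 * β ^ 2) + (μ22 / (3 * β ^ 2)) * w2)
          (fun w1 _ => κ1 ^ 2 * η20 - (μ22 / (3 * β ^ 2)) * w1)
          (fun w1 w2 => μ20 * w1 + μ21 * w2 + μ22 * w1 * w2)
          (fun w => p1 * Real.sin (Real.sqrt 2 * β * w) + p2 * Real.cos (Real.sqrt 2 * β * w))
          (fun w => q1 * Real.exp (-β * w) + q2 * Real.exp (β * w)) z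
        = (μ21 + β ^ 2 * κ1 ^ 2 * η20)
          * (q1 * Real.exp (-β * z) + q2 * Real.exp (β * z))) := by
  intro p1 p2 q1 q2 z
  have h1 := hasDerivAt_sin_add_cos p1 p2 (√2 * β)
  have h1' := hasDerivAt_sin_add_cos (-(√2 * β * p2)) (√2 * β * p1) (√2 * β) z
  have h2 := hasDerivAt_exp_neg_add_exp q1 q2 β
  have h2' := hasDerivAt_exp_neg_add_exp (-(β * q1)) (β * q2) β z
  have hs : √2 ^ 2 = (2 : ℝ) := Real.sq_sqrt zero_le_two
  constructor
  · simp only [neg_add']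
    rw [Aop_of_affine h1 h2 h1' h2']
    field_simp
    ring_nf
    simp only [hs]
    ring
  · rw [Aop_of_affine h1 h2 h1' h2']
    field_simp
    ring_nf
    simp only [hs]
    ring
end
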